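/- arXiv:0907.3903 — 6 statements merged into one kernel-verified Lean document; each statement's English description precedes it below -/
import Mathlib

section
/- The quotient of ℂ[z₁,z₂,z₃] by the Jacobian ideal I of W is a finite-dimensional complex vector space. -/
open MvPolynomial

/-- The superpotential `W = -z₁z₂z₃ + z₁^{2g+1} + z₂^{2g+1} + z₃^{2g+1}`
of the Landau–Ginzburg mirror to a genus-`g` curve. -/
noncomputable def superpotential (g : ℕ) : MvPolynomial (Fin 3) ℂ :=
  - (X 0 * X 1 * X 2) + X 0 ^ (2 * g + 1) + X 1 ^ (2 * g + 1) + X 2 ^ (2 * g + 1)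

/-- The Jacobian ideal `I` of `W`, generated by the three partial derivatives. -/
noncomputable def jacobianIdeal (g : ℕ) : Ideal (MvPolynomial (Fin 3) ℂ) :=
  Ideal.span {pderiv 0 (superpotential g), pderiv 1 (superpotential g),
    pderiv 2 (superpotential g)}

/-- If `x`, `y`, `z` satisfy the cyclic relations `x ^ m = u y z`, `y ^ m = u x z`,
`z ^ m = u x y` with `m ≥ 3`, then `x ^ (m * m) = u ^ (m + 1) x ^ (m + 2)`, so `x` is integral. -/
lemma isIntegral_of_pow_eq_mul {R A : Type*} [CommRing R] [CommRing A] [Algebra R A]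
    {m : ℕ} (hm : 3 ≤ m) (u : R) {x y z : A}
    (hx : x ^ m = algebraMap R A u * (y * z))
    (hy : y ^ m = algebraMap R A u * (x * z))
    (hz : z ^ m = algebraMap R A u * (x * y)) : IsIntegral R x := by
  nontriviality R
  have key : x ^ (m * m) = algebraMap R A u ^ (m + 1) * x ^ (m + 2) := by
    calc x ^ (m * m) = algebraMap R A u ^ m * (y ^ m * z ^ m) := by
          rw [pow_mul, hx, mul_pow, mul_pow]
      _ = algebraMap R A u ^ (m + 1) * (x ^ 2 * (algebraMap R A u * (y * z))) := by
          rw [hy, hz]; ring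
      _ = algebraMap R A u ^ (m + 1) * x ^ (m + 2) := by rw [← hx]; ring
  refine ⟨Polynomial.X ^ (m * m) - Polynomial.C (u ^ (m + 1)) * Polynomial.X ^ (m + 2), ?_, ?_⟩
  · refine Polynomial.monic_X_pow_sub (n := m * m)
      ((Polynomial.degree_C_mul_X_pow_le _ _).trans_lt ?_)
    exact_mod_cast (by nlinarith : m + 2 < m * m)
  · simp [key]

/-- A quotient of a polynomial ring in finitely many variables is a finite module as soon as
the classes of the variables are integral. -/
lemma finite_quotient_of_isIntegral_X {R σ : Type*} [CommRing R] [Finite σ]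
    (I : Ideal (MvPolynomial σ R))
    (h : ∀ i, IsIntegral R (Ideal.Quotient.mk I (X i))) :
    Module.Finite R (MvPolynomial σ R ⧸ I) := by
  have : Algebra.IsIntegral R (MvPolynomial σ R ⧸ I) := by
    refine ⟨fun a => ?_⟩
    obtain ⟨p, rfl⟩ := Ideal.Quotient.mk_surjective a
    induction p using MvPolynomial.induction_on with
    | C r => exact isIntegral_algebraMap (R := R) (A := MvPolynomial σ R ⧸ I) (x := r)
    | add p q hp hq => rw [map_add]; exact hp.add hq
    | mul_X p i hp => rw [map_mul]; exact hp.mul (h i)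
  exact Algebra.IsIntegral.finite

/-- In a quotient of a polynomial ring over a field, a relation `n Xᵢ ^ m - Xⱼ Xₖ = 0` can be solved for
`Xᵢ ^ m`. -/
lemma mk_X_pow_eq {σ K : Type*} [Field K] (I : Ideal (MvPolynomial σ K)) {n : K} (hn : n ≠ 0)
    {m : ℕ} {i j k : σ} (h : C n * X i ^ m - X j * X k ∈ I) :
    Ideal.Quotient.mk I (X i) ^ m = algebraMap K (MvPolynomial σ K ⧸ I) n⁻¹ *
      (Ideal.Quotient.mk I (X j) * Ideal.Quotient.mk I (X k)) := by
  have e : algebraMap K (MvPolynomial σ K ⧸ I) n⁻¹ = Ideal.Quotient.mk I (C n⁻¹) := rfl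
  rw [e, ← map_pow, ← map_mul, ← map_mul, Ideal.Quotient.eq]
  convert I.mul_mem_left (C n⁻¹) h using 1
  rw [mul_sub, ← mul_assoc (C n⁻¹) (C n), ← C_mul, inv_mul_cancel₀ hn, C_1, one_mul]

/-- The quotient of `ℂ[z₁,z₂,z₃]` by the Jacobian ideal of `W` is a finite-dimensional
complex vector space. -/
theorem stmt_3 (g : ℕ) (hg : 3 ≤ g) :
    FiniteDimensional ℂ (MvPolynomial (Fin 3) ℂ ⧸ jacobianIdeal g) := by
  have hn : ((2 * g + 1 : ℕ) : ℂ) ≠ 0 := Nat.cast_ne_zero.2 (by omega)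
  have h0 : C ((2 * g + 1 : ℕ) : ℂ) * X 0 ^ (2 * g) - X 1 * X 2 ∈ jacobianIdeal g := by
    have : pderiv 0 (superpotential g) ∈ jacobianIdeal g := Ideal.subset_span (by simp)
    convert this using 1
    rw [map_natCast]
    simp [superpotential, pderiv_X, Derivation.leibniz_pow]
    ring
  have h1 : C ((2 * g + 1 : ℕ) : ℂ) * X 1 ^ (2 * g) - X 0 * X 2 ∈ jacobianIdeal g := by
    have : pderiv 1 (superpotential g) ∈ jacobianIdeal g := Ideal.subset_span (by simp)
    convert this using 1
    rw [map_natCast]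
    simp [superpotential, pderiv_X, Derivation.leibniz_pow]
    ring
  have h2 : C ((2 * g + 1 : ℕ) : ℂ) * X 2 ^ (2 * g) - X 0 * X 1 ∈ jacobianIdeal g := by
    have : pderiv 2 (superpotential g) ∈ jacobianIdeal g := Ideal.subset_span (by simp)
    convert this using 1
    rw [map_natCast]
    simp [superpotential, pderiv_X, Derivation.leibniz_pow]
    ring
  have r0 := mk_X_pow_eq _ hn h0
  have r1 := mk_X_pow_eq _ hn h1
  have r2 := mk_X_pow_eq _ hn h2
  have hm : 3 ≤ 2 * g := by omega
  refine finite_quotient_of_isIntegral_X _ fun i => ?_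
  match i with
  | 0 => exact isIntegral_of_pow_eq_mul hm _ r0 r1 r2
  | 1 => exact isIntegral_of_pow_eq_mul hm _ r1 r0 (by rw [r2]; ring)
  | 2 => exact isIntegral_of_pow_eq_mul hm _ r2 (by rw [r0]; ring) (by rw [r1]; ring)
end

section
/- The sequence (∂W/∂z₁, ∂W/∂z₂, ∂W/∂z₃) of partial derivatives of W is a regular sequence in the formal power series ring ℂ[[z₁,z₂,z₃]]. -/
open MvPolynomial

namespace MvPowerSeries

/-- The ideal `(X i, X j ^ m)` consists of the series whose coefficients vanish at all
monomials not divisible by `X i` or `X j ^ m`. -/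
lemma mem_span_X_X_pow_iff {σ R : Type*} [CommRing R] {i j : σ} {m : ℕ}
    {v : MvPowerSeries σ R} :
    v ∈ Ideal.span {(X i : MvPowerSeries σ R), X j ^ m} ↔
      ∀ d : σ →₀ ℕ, d i = 0 → d j < m → coeff d v = 0 := by
  classical
  rw [Ideal.mem_span_pair]
  constructor
  · rintro ⟨a, b, rfl⟩ d hi hj
    rw [map_add, X_dvd_iff.1 (Dvd.intro_left a rfl) d hi,
      X_pow_dvd_iff.1 (Dvd.intro_left b rfl) d hj, add_zero]
  · intro h
    let p : MvPowerSeries σ R := fun d => if d i = 0 then 0 else coeff d v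
    have hp (d : σ →₀ ℕ) : coeff d p = if d i = 0 then 0 else coeff d v := rfl
    obtain ⟨a, ha⟩ : (X i : MvPowerSeries σ R) ∣ p :=
      X_dvd_iff.2 fun d hd => by rw [hp, if_pos hd]
    obtain ⟨b, hb⟩ : (X j : MvPowerSeries σ R) ^ m ∣ v - p := X_pow_dvd_iff.2 fun d hd => by
      rw [map_sub, hp]
      split_ifs with hi
      · rw [h d hi hd, sub_zero]
      · rw [sub_self]
    exact ⟨a, b, by linear_combination -ha - hb⟩

/-- `X k ^ l` is a nonzerodivisor modulo `(X i, X j ^ m)` for distinct variables. -/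
lemma mem_span_X_X_pow_of_X_pow_mul_mem {σ R : Type*} [CommRing R] {i j k : σ} {m l : ℕ}
    (hki : k ≠ i) (hkj : k ≠ j) {v : MvPowerSeries σ R}
    (h : X k ^ l * v ∈ Ideal.span {(X i : MvPowerSeries σ R), X j ^ m}) :
    v ∈ Ideal.span {(X i : MvPowerSeries σ R), X j ^ m} := by
  classical
  rw [mem_span_X_X_pow_iff] at h ⊢
  intro d hi hj
  have := h (Finsupp.single k l + d) (by simp [hi, hki]) (by simp [hj, hkj])
  rwa [X_pow_eq, coeff_add_monomial_mul, one_mul] at this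

/-- `X j ^ m` is a nonzerodivisor modulo `X i` for distinct variables. -/
lemma X_dvd_of_X_dvd_X_pow_mul {σ R : Type*} [CommRing R] {i j : σ} {m : ℕ}
    (hji : j ≠ i) {v : MvPowerSeries σ R} (h : X i ∣ X j ^ m * v) : X i ∣ v := by
  classical
  rw [X_dvd_iff] at h ⊢
  intro d hi
  have := h (Finsupp.single j m + d) (by simp [hi, hji])
  rwa [X_pow_eq, coeff_add_monomial_mul, one_mul] at this

lemma _root_.isWeaklyRegular_triple_iff {R : Type*} [CommRing R] (a b c : R) :
    RingTheory.Sequence.IsWeaklyRegular R [a, b, c] ↔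
      (∀ x, a * x = 0 → x = 0) ∧ (∀ x, b * x ∈ Ideal.span {a} → x ∈ Ideal.span {a}) ∧
      (∀ x, c * x ∈ Ideal.span {a, b} → x ∈ Ideal.span {a, b}) := by
  rw [RingTheory.Sequence.isWeaklyRegular_iff_Fin]
  simp [Fin.forall_fin_succ, isSMulRegular_quotient_iff_mem_of_smul_mem, Ideal.ofList]
  have h : {r | r = a ∨ r = b} = ({a, b} : Set R) := rfl
  simp [h]

/-- The sequence `(z, c xᵐ - yz, c yᵐ - xz)` is weakly regular when `c` is a unit. -/
lemma isWeaklyRegular_X_two_cons {R : Type*} [CommRing R] [IsDomain R] (m : ℕ)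
    {c : MvPowerSeries (Fin 3) R} (hc : IsUnit c) :
    RingTheory.Sequence.IsWeaklyRegular (MvPowerSeries (Fin 3) R)
      [X 2, c * X 0 ^ m - X 1 * X 2, c * X 1 ^ m - X 0 * X 2] := by
  have hspan : Ideal.span {(X 2 : MvPowerSeries (Fin 3) R), c * X 0 ^ m - X 1 * X 2} =
      Ideal.span {X 2, X 0 ^ m} := by
    rw [show c * X 0 ^ m - X 1 * X 2 = c * X 0 ^ m + -(X 1 : MvPowerSeries (Fin 3) R) * X 2 by ring,
      Ideal.span_pair_add_mul_left, Ideal.span_insert, Ideal.span_singleton_mul_left_unit hc,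
      ← Ideal.span_insert]
  have hX : (X 2 : MvPowerSeries (Fin 3) R) ≠ 0 := fun h => by
    simpa [h] using coeff_index_single_self_X (R := R) (2 : Fin 3)
  rw [isWeaklyRegular_triple_iff, hspan]
  refine ⟨fun x hx => (mul_eq_zero.1 hx).resolve_left hX, fun x hx => ?_, fun x hx => ?_⟩
  · rw [Ideal.mem_span_singleton] at hx ⊢
    refine X_dvd_of_X_dvd_X_pow_mul (j := 0) (m := m) (by decide) ((hc.dvd_mul_left).1 ?_)
    have h := dvd_add hx (Dvd.intro (X 1 * x) rfl)
    convert h using 1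
    ring
  · refine mem_span_X_X_pow_of_X_pow_mul_mem (k := 1) (l := m) (by decide) (by decide)
      ((Ideal.unit_mul_mem_iff_mem _ hc).1 ?_)
    have h := add_mem hx (Ideal.mul_mem_right (X 0 * x) _
      (Ideal.subset_span (Set.mem_insert (X 2) {X 0 ^ m})))
    convert h using 1
    ring

/-- If `z` is a nonzerodivisor and `yz = c xᵐ`, `xz = c yᵐ`, then `c zᵐ - xy` is a nonzerodivisor,
provided `c` and `1 - c³(xyz)ᵐ⁻²` are units. -/
lemma _root_.eq_zero_of_sub_mul_eq_zero {Q : Type*} [CommRing Q] {x y z c v : Q} {k : ℕ}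
    (hz : ∀ w, z * w = 0 → w = 0) (hc : IsUnit c)
    (hu : IsUnit (1 - c ^ 3 * (x * y * z) ^ k))
    (h0 : c * x ^ (k + 2) - y * z = 0) (h1 : c * y ^ (k + 2) - x * z = 0)
    (hv : (c * z ^ (k + 2) - x * y) * v = 0) : v = 0 := by
  have hpow (w : Q) (j : ℕ) (h : z ^ j * w = 0) : w = 0 := by
    induction j with
    | zero => simpa using h
    | succ j ih => exact ih (hz _ (by rw [← h]; ring))
  have hp : (1 - c ^ 3 * (x * y * z) ^ k) * ((x * y * z) ^ 2 * v) = 0 := by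
    have hxyz : (x * y * z) ^ 2 * v = (y * z) * (x * z) * (x * y * v) := by ring
    have h0' : y * z = c * x ^ (k + 2) := (sub_eq_zero.1 h0).symm
    have h1' : x * z = c * y ^ (k + 2) := (sub_eq_zero.1 h1).symm
    have hv' : x * y * v = c * z ^ (k + 2) * v := by linear_combination -hv
    have h : (x * y * z) ^ 2 * v = c ^ 3 * (x * y * z) ^ k * ((x * y * z) ^ 2 * v) := by
      conv_lhs => rw [hxyz, h0', h1', hv']
      ring
    linear_combination h
  rw [hu.mul_right_eq_zero] at hp
  refine hpow v (2 * (k + 3)) ((hc.pow 2).mul_right_eq_zero.1 ?_)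
  linear_combination hp + (c * z ^ (k + 3) * z + x * y * z * z) * hv

end MvPowerSeries

lemma coe_C_mul_X_pow_sub {σ R : Type*} [CommRing R] (a : R) (i p q : σ) (m : ℕ) :
    ((C a * X i ^ m - X p * X q : MvPolynomial σ R) : MvPowerSeries σ R) =
      MvPowerSeries.C a * MvPowerSeries.X i ^ m - MvPowerSeries.X p * MvPowerSeries.X q := by
  rw [← coeToMvPowerSeries.ringHom_apply, map_sub]
  simp

lemma pderiv_superpotential_zero (g : ℕ) : pderiv 0 (superpotential g) =
    C (2 * g + 1 : ℂ) * X 0 ^ (2 * g) - X 1 * X 2 := by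
  simp only [superpotential, map_add, map_mul, map_one, map_natCast, map_ofNat]
  simp [pderiv_X]
  ring

lemma pderiv_superpotential_one (g : ℕ) : pderiv 1 (superpotential g) =
    C (2 * g + 1 : ℂ) * X 1 ^ (2 * g) - X 0 * X 2 := by
  simp only [superpotential, map_add, map_mul, map_one, map_natCast, map_ofNat]
  simp [pderiv_X]
  ring

lemma pderiv_superpotential_two (g : ℕ) : pderiv 2 (superpotential g) =
    C (2 * g + 1 : ℂ) * X 2 ^ (2 * g) - X 0 * X 1 := by
  simp only [superpotential, map_add, map_mul, map_one, map_natCast, map_ofNat]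
  simp [pderiv_X]
  ring

/-- The sequence `(∂W/∂z₁, ∂W/∂z₂, ∂W/∂z₃)` is a regular sequence in the formal power
series ring `ℂ[[z₁,z₂,z₃]]`: each `fᵢ` is a nonzerodivisor modulo the previous ones, and
the quotient by all three is nonzero. -/
theorem stmt_4 (g : ℕ) (hg : 3 ≤ g)
    (f : Fin 3 → MvPowerSeries (Fin 3) ℂ)
    (hf : ∀ i, f i = ((pderiv i (superpotential g) : MvPolynomial (Fin 3) ℂ) :
      MvPowerSeries (Fin 3) ℂ)) :
    (∀ x : MvPowerSeries (Fin 3) ℂ, f 0 * x = 0 → x = 0) ∧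
    (∀ x : MvPowerSeries (Fin 3) ℂ ⧸ Ideal.span {f 0},
      Ideal.Quotient.mk (Ideal.span {f 0}) (f 1) * x = 0 → x = 0) ∧
    (∀ x : MvPowerSeries (Fin 3) ℂ ⧸ Ideal.span {f 0, f 1},
      Ideal.Quotient.mk (Ideal.span {f 0, f 1}) (f 2) * x = 0 → x = 0) ∧
    Nontrivial (MvPowerSeries (Fin 3) ℂ ⧸ Ideal.span {f 0, f 1, f 2}) := by
  obtain ⟨k, hk⟩ : ∃ k, 2 * g = k + 1 + 2 := ⟨2 * g - 3, by omega⟩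
  set c : MvPowerSeries (Fin 3) ℂ := MvPowerSeries.C (2 * g + 1 : ℂ) with hcdef
  have hc : IsUnit c := by
    refine IsUnit.map _ (isUnit_iff_ne_zero.2 ?_)
    exact_mod_cast Nat.succ_ne_zero (2 * g)
  have f0 : f 0 = c * MvPowerSeries.X 0 ^ (k + 1 + 2) - MvPowerSeries.X 1 * MvPowerSeries.X 2 := by
    rw [hf, pderiv_superpotential_zero, coe_C_mul_X_pow_sub, hk]
  have f1 : f 1 = c * MvPowerSeries.X 1 ^ (k + 1 + 2) - MvPowerSeries.X 0 * MvPowerSeries.X 2 := by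
    rw [hf, pderiv_superpotential_one, coe_C_mul_X_pow_sub, hk]
  have f2 : f 2 = c * MvPowerSeries.X 2 ^ (k + 1 + 2) - MvPowerSeries.X 0 * MvPowerSeries.X 1 := by
    rw [hf, pderiv_superpotential_two, coe_C_mul_X_pow_sub, hk]
  have hmax (r : MvPowerSeries (Fin 3) ℂ) (hr : MvPowerSeries.constantCoeff r = 0) :
      r ∈ IsLocalRing.maximalIdeal (MvPowerSeries (Fin 3) ℂ) := by
    rw [IsLocalRing.mem_maximalIdeal, mem_nonunits_iff, MvPowerSeries.isUnit_iff_constantCoeff, hr]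
    exact not_isUnit_zero
  have hf0 : MvPowerSeries.constantCoeff (f 0) = 0 := by simp [f0]
  have hf1 : MvPowerSeries.constantCoeff (f 1) = 0 := by simp [f1]
  have hf2 : MvPowerSeries.constantCoeff (f 2) = 0 := by simp [f2]
  have hreg : RingTheory.Sequence.IsWeaklyRegular (MvPowerSeries (Fin 3) ℂ)
      [f 0, f 1, MvPowerSeries.X 2] := by
    refine IsLocalRing.isWeaklyRegular_of_perm_of_subset_maximalIdeal
      (rs := [MvPowerSeries.X 2, f 0, f 1]) ?_
      (List.perm_append_comm (l₁ := [MvPowerSeries.X 2])) ?_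
    · rw [f0, f1]
      exact MvPowerSeries.isWeaklyRegular_X_two_cons _ hc
    · simp only [List.mem_cons, List.not_mem_nil, or_false]
      rintro r (rfl | rfl | rfl)
      exacts [hmax _ (MvPowerSeries.constantCoeff_X 2), hmax _ hf0, hmax _ hf1]
  rw [isWeaklyRegular_triple_iff] at hreg
  obtain ⟨h0, h1, h2⟩ := hreg
  refine ⟨h0, ?_, ?_, ?_⟩
  · rw [Ideal.Quotient.mk_surjective.forall]
    intro x
    rw [← map_mul, Ideal.Quotient.eq_zero_iff_mem, Ideal.Quotient.eq_zero_iff_mem]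
    exact h1 x
  · intro v hv
    set q := Ideal.Quotient.mk (Ideal.span {f 0, f 1})
    refine eq_zero_of_sub_mul_eq_zero (x := q (MvPowerSeries.X 0))
      (y := q (MvPowerSeries.X 1)) (z := q (MvPowerSeries.X 2))
      (c := q c) (k := k + 1) ?_ (hc.map q) ?_ ?_ ?_ ?_
    · rw [Ideal.Quotient.mk_surjective.forall]
      intro x
      rw [← map_mul, Ideal.Quotient.eq_zero_iff_mem, Ideal.Quotient.eq_zero_iff_mem]
      exact h2 x
    · have : IsUnit (1 - c ^ 3 *
          (MvPowerSeries.X 0 * MvPowerSeries.X 1 * MvPowerSeries.X 2) ^ (k + 1)) := by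
        rw [MvPowerSeries.isUnit_iff_constantCoeff]
        simp
      simpa using this.map q
    · have : q (f 0) = 0 := Ideal.Quotient.eq_zero_iff_mem.2 (Ideal.subset_span (by simp))
      simpa [f0] using this
    · have : q (f 1) = 0 := Ideal.Quotient.eq_zero_iff_mem.2 (Ideal.subset_span (by simp))
      simpa [f1] using this
    · simpa [f2] using hv
  · refine Ideal.Quotient.nontrivial_iff.2 (ne_top_of_le_ne_top
      (IsLocalRing.maximalIdeal.isMaximal _).ne_top (Ideal.span_le.2 ?_))
    rintro r (rfl | rfl | rfl)
    exacts [hmax _ hf0, hmax _ hf1, hmax _ hf2]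
end

section
/- In ℂ[z₁,z₂,z₃] one has the exact identity z₁^{2g+2} = (1/(2g+1))·z₁²·(∂W/∂z₁) − (1/(2g+1))·z₁z₂·(∂W/∂z₂) − z₂^{2g}·(∂W/∂z₃) + (2g+1)·z₂^{2g}z₃^{2g}; in particular z₁^{2g+2} ∈ I·F₂ + F_{4g}, where I·F₂ denotes the set of sums of products of an element of I with an element of F₂. -/
open MvPolynomial

/-- `Fdeg m` is the ideal of polynomials all of whose nonzero monomials have total
degree at least `m`. -/
noncomputable def Fdeg (m : ℕ) : Ideal (MvPolynomial (Fin 3) ℂ) where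
  carrier := {p | ∀ d ∈ p.support, m ≤ d.sum fun _ e => e}
  zero_mem' := by simp
  add_mem' := by
    intro a b ha hb d hd
    rcases Finset.mem_union.mp (MvPolynomial.support_add hd) with h | h
    · exact ha d h
    · exact hb d h
  smul_mem' := by
    intro c p hp d hd
    rw [smul_eq_mul] at hd
    obtain ⟨d1, _, d2, hd2, rfl⟩ := Finset.mem_add.mp (MvPolynomial.support_mul c p hd)
    have h2 := hp d2 hd2
    have hsum : (d1 + d2).sum (fun _ e => e) =
        d1.sum (fun _ e => e) + d2.sum (fun _ e => e) :=
      Finsupp.sum_add_index' (fun _ => rfl) (fun _ _ _ => rfl)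
    omega

/-- A homogeneous polynomial of degree `n ≥ m` lies in `Fdeg m`. -/
theorem MvPolynomial.IsHomogeneous.mem_Fdeg {p : MvPolynomial (Fin 3) ℂ} {m n : ℕ}
    (hp : p.IsHomogeneous n) (hmn : m ≤ n) : p ∈ Fdeg m := by
  intro d hd
  have h : d.degree = n := by
    by_contra hne
    exact mem_support_iff.mp hd (hp.coeff_eq_zero hne)
  exact hmn.trans h.ge

theorem pderiv_zero_superpotential (g : ℕ) :
    pderiv 0 (superpotential g) =
      -(X 1 * X 2) + C ((2 * g + 1 : ℕ) : ℂ) * X 0 ^ (2 * g) := by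
  rw [map_natCast]
  simp [superpotential, pderiv_X, mul_comm]

theorem pderiv_one_superpotential (g : ℕ) :
    pderiv 1 (superpotential g) =
      -(X 0 * X 2) + C ((2 * g + 1 : ℕ) : ℂ) * X 1 ^ (2 * g) := by
  rw [map_natCast]
  simp [superpotential, pderiv_X, mul_comm]

theorem pderiv_two_superpotential (g : ℕ) :
    pderiv 2 (superpotential g) =
      -(X 0 * X 1) + C ((2 * g + 1 : ℕ) : ℂ) * X 2 ^ (2 * g) := by
  rw [map_natCast]
  simp [superpotential, pderiv_X]

/-- The expression of `z₁^{2g+2}` through the partial derivatives of `W`. -/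
theorem X_zero_pow_eq_pderiv_superpotential (g : ℕ) :
    (X 0 ^ (2 * g + 2) : MvPolynomial (Fin 3) ℂ) =
      C (((2 * g + 1 : ℕ) : ℂ))⁻¹ * X 0 ^ 2 * pderiv 0 (superpotential g)
      - C (((2 * g + 1 : ℕ) : ℂ))⁻¹ * (X 0 * X 1) * pderiv 1 (superpotential g)
      - X 1 ^ (2 * g) * pderiv 2 (superpotential g)
      + C ((2 * g + 1 : ℕ) : ℂ) * (X 1 ^ (2 * g) * X 2 ^ (2 * g)) := by
  have hC : (C (((2 * g + 1 : ℕ) : ℂ))⁻¹ * C ((2 * g + 1 : ℕ) : ℂ) :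
      MvPolynomial (Fin 3) ℂ) = 1 := by
    rw [← C_mul, inv_mul_cancel₀ (Nat.cast_ne_zero.mpr (Nat.succ_ne_zero _)), C_1]
  rw [pderiv_zero_superpotential, pderiv_one_superpotential, pderiv_two_superpotential]
  linear_combination
    (X 0 * X 1 * X 1 ^ (2 * g) - X 0 ^ 2 * X 0 ^ (2 * g) : MvPolynomial (Fin 3) ℂ) * hC

/-- The exact identity
`z₁^{2g+2} = (1/(2g+1))·z₁²·∂₁W − (1/(2g+1))·z₁z₂·∂₂W − z₂^{2g}·∂₃W + (2g+1)·z₂^{2g}z₃^{2g}`;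
in particular `z₁^{2g+2} ∈ I·F₂ + F_{4g}`. -/
theorem stmt_5 (g : ℕ) (hg : 3 ≤ g) :
    (X 0 ^ (2 * g + 2) : MvPolynomial (Fin 3) ℂ) =
      C (((2 * g + 1 : ℕ) : ℂ))⁻¹ * X 0 ^ 2 * pderiv 0 (superpotential g)
      - C (((2 * g + 1 : ℕ) : ℂ))⁻¹ * (X 0 * X 1) * pderiv 1 (superpotential g)
      - X 1 ^ (2 * g) * pderiv 2 (superpotential g)
      + C ((2 * g + 1 : ℕ) : ℂ) * (X 1 ^ (2 * g) * X 2 ^ (2 * g)) ∧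
    (X 0 ^ (2 * g + 2) : MvPolynomial (Fin 3) ℂ) ∈
      jacobianIdeal g * Fdeg 2 + Fdeg (4 * g) := by
  refine ⟨X_zero_pow_eq_pderiv_superpotential g, ?_⟩
  have hX (i : Fin 3) : (X i : MvPolynomial (Fin 3) ℂ).IsHomogeneous 1 := isHomogeneous_X ℂ i
  have hmem {p q : MvPolynomial (Fin 3) ℂ} (hp : p ∈ jacobianIdeal g) (hq : q ∈ Fdeg 2) :
      q * p ∈ jacobianIdeal g * Fdeg 2 := mul_comm p q ▸ Ideal.mul_mem_mul hp hq
  rw [X_zero_pow_eq_pderiv_superpotential g]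
  refine Submodule.add_mem_sup (sub_mem (sub_mem (hmem ?_ ?_) (hmem ?_ ?_)) (hmem ?_ ?_)) ?_
  · exact Ideal.subset_span (by simp)
  · exact Ideal.mul_mem_left _ _ (((hX 0).pow 2).mem_Fdeg (by omega))
  · exact Ideal.subset_span (by simp)
  · exact Ideal.mul_mem_left _ _ (((hX 0).mul (hX 1)).mem_Fdeg (by omega))
  · exact Ideal.subset_span (by simp)
  · exact ((hX 1).pow (2 * g)).mem_Fdeg (by omega)
  · exact Ideal.mul_mem_left _ _
      ((((hX 1).pow (2 * g)).mul ((hX 2).pow (2 * g))).mem_Fdeg (by omega))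
end

section
/- For each 0 ≤ k ≤ g−1, the triple {v_k, v_{k+1}, (1,0,0)} generates the lattice N as an abelian group, and so does the triple {v_k, v_{k+1}, (0,1,0)}; moreover the triple {v_g, (1,0,0), (0,1,0)} also generates N. Hence every maximal cone of the fan Σ′ is smooth (unimodular) with respect to N, so the toric variety X = X_{Σ′} is smooth. -/
/-- The generator `u = (1/(2g+1))·(1,1,2g−1)` of the lattice `N = ℤ³ + ℤ·u ⊂ ℚ³`. -/
noncomputable def uvec (g : ℕ) : Fin 3 → ℚ :=
  (2 * (g : ℚ) + 1)⁻¹ • ![1, 1, 2 * (g : ℚ) - 1]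

/-- The ray generators `v_k = (1/(2g+1))·(k, k, 2g+1−2k)` of the fan of the crepant
resolution `X = Hilb_K(ℂ³)`. -/
noncomputable def vvec (g k : ℕ) : Fin 3 → ℚ :=
  (2 * (g : ℚ) + 1)⁻¹ • ![(k : ℚ), (k : ℚ), 2 * (g : ℚ) + 1 - 2 * (k : ℚ)]

/-- The lattice `N = ℤ³ + ℤ·u ⊂ ℚ³`, as the subgroup generated by the integer vectors
together with `u`. -/
noncomputable def latticeN (g : ℕ) : AddSubgroup (Fin 3 → ℚ) :=
  AddSubgroup.closure ((Set.range fun a : Fin 3 → ℤ => fun i => ((a i : ℚ))) ∪ {uvec g})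

theorem int_vec_mem_latticeN (g : ℕ) (a : Fin 3 → ℤ) :
    (fun i => (a i : ℚ)) ∈ latticeN g :=
  AddSubgroup.subset_closure (Or.inl ⟨a, rfl⟩)

theorem e₁_mem_latticeN (g : ℕ) : (![1, 0, 0] : Fin 3 → ℚ) ∈ latticeN g := by
  convert int_vec_mem_latticeN g ![1, 0, 0] using 1
  ext i; fin_cases i <;> simp

theorem e₂_mem_latticeN (g : ℕ) : (![0, 1, 0] : Fin 3 → ℚ) ∈ latticeN g := by
  convert int_vec_mem_latticeN g ![0, 1, 0] using 1
  ext i; fin_cases i <;> simp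

theorem e₃_mem_latticeN (g : ℕ) : (![0, 0, 1] : Fin 3 → ℚ) ∈ latticeN g := by
  convert int_vec_mem_latticeN g ![0, 0, 1] using 1
  ext i; fin_cases i <;> simp

theorem uvec_mem_latticeN (g : ℕ) : uvec g ∈ latticeN g :=
  AddSubgroup.subset_closure (Or.inr rfl)

/-- The rays lie on the line through `e₃` with direction `u - e₃`. -/
theorem vvec_eq (g k : ℕ) :
    vvec g k = ![0, 0, 1] + k • (uvec g - ![0, 0, 1]) := by
  have hn : (2 * (g : ℚ) + 1) ≠ 0 := by positivity
  ext i; fin_cases i <;> simp [vvec, uvec] <;> field_simp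
  ring

theorem vvec_mem_latticeN (g k : ℕ) : vvec g k ∈ latticeN g := by
  rw [vvec_eq]
  exact add_mem (e₃_mem_latticeN g)
    (nsmul_mem (sub_mem (uvec_mem_latticeN g) (e₃_mem_latticeN g)) k)

theorem nsmul_uvec_sub_e₃ (g : ℕ) :
    (2 * g + 1) • (uvec g - ![0, 0, 1]) = ![1, 0, 0] + ![0, 1, 0] - 2 • ![0, 0, 1] := by
  have hn : (2 * (g : ℚ) + 1) ≠ 0 := by positivity
  ext i; fin_cases i <;> simp [uvec] <;> field_simp
  ring

theorem latticeN_le {g : ℕ} {H : AddSubgroup (Fin 3 → ℚ)} (h₁ : ![1, 0, 0] ∈ H)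
    (h₂ : ![0, 1, 0] ∈ H) (h₃ : ![0, 0, 1] ∈ H) (hu : uvec g ∈ H) : latticeN g ≤ H := by
  rw [latticeN, AddSubgroup.closure_le]
  rintro _ (⟨a, rfl⟩ | rfl)
  · have ha : (fun i => (a i : ℚ)) =
        a 0 • ![1, 0, 0] + a 1 • ![0, 1, 0] + a 2 • ![0, 0, 1] := by
      ext i; fin_cases i <;> simp
    change (fun i => (a i : ℚ)) ∈ H
    rw [ha]
    exact add_mem (add_mem (zsmul_mem h₁ _) (zsmul_mem h₂ _)) (zsmul_mem h₃ _)
  · exact hu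

theorem e₃_mem_of_vvec_mem {g k : ℕ} {H : AddSubgroup (Fin 3 → ℚ)} (hv : vvec g k ∈ H)
    (hd : uvec g - ![0, 0, 1] ∈ H) : ![0, 0, 1] ∈ H := by
  rw [vvec_eq] at hv
  exact (add_mem_cancel_right (nsmul_mem hd k)).1 hv

theorem uvec_sub_e₃_mem {g k : ℕ} {H : AddSubgroup (Fin 3 → ℚ)} (hv : vvec g k ∈ H)
    (hw : vvec g (k + 1) ∈ H) : uvec g - ![0, 0, 1] ∈ H := by
  have h := sub_mem hw hv
  rwa [vvec_eq, vvec_eq, succ_nsmul, add_sub_add_left_eq_sub, add_sub_cancel_left] at h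

theorem e₁_add_e₂_mem {g : ℕ} {H : AddSubgroup (Fin 3 → ℚ)} (h₃ : ![0, 0, 1] ∈ H)
    (hd : uvec g - ![0, 0, 1] ∈ H) : (![1, 0, 0] + ![0, 1, 0] : Fin 3 → ℚ) ∈ H := by
  have h := add_mem (nsmul_mem hd (2 * g + 1)) (nsmul_mem h₃ 2)
  rwa [nsmul_uvec_sub_e₃, sub_add_cancel] at h

theorem uvec_sub_e₃_eq (g : ℕ) :
    uvec g - ![0, 0, 1] = ![1, 0, 0] + ![0, 1, 0] - 2 • vvec g g := by
  rw [vvec_eq, nsmul_add, ← mul_nsmul', ← sub_sub, ← nsmul_uvec_sub_e₃, succ_nsmul,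
    add_sub_cancel_left]

/-- For each `0 ≤ k ≤ g−1` the triples `{v_k, v_{k+1}, e₁}` and `{v_k, v_{k+1}, e₂}`
generate the lattice `N` as an abelian group, and so does `{v_g, e₁, e₂}`: every maximal
cone of the fan `Σ′` is unimodular, so the toric variety `X = X_{Σ′}` is smooth. -/
theorem stmt_16 (g : ℕ) (hg : 3 ≤ g) :
    (∀ k : ℕ, k + 1 ≤ g →
      AddSubgroup.closure {vvec g k, vvec g (k + 1), (![1, 0, 0] : Fin 3 → ℚ)}
          = latticeN g ∧
      AddSubgroup.closure {vvec g k, vvec g (k + 1), (![0, 1, 0] : Fin 3 → ℚ)}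
          = latticeN g) ∧
    AddSubgroup.closure {vvec g g, (![1, 0, 0] : Fin 3 → ℚ), (![0, 1, 0] : Fin 3 → ℚ)}
        = latticeN g := by
  have hu {H : AddSubgroup (Fin 3 → ℚ)} (h₃ : ![0, 0, 1] ∈ H)
      (hd : uvec g - ![0, 0, 1] ∈ H) : uvec g ∈ H := by
    simpa only [sub_add_cancel] using add_mem hd h₃
  refine ⟨fun k _ => ⟨le_antisymm ?_ ?_, le_antisymm ?_ ?_⟩, le_antisymm ?_ ?_⟩
  · rw [AddSubgroup.closure_le]
    rintro _ (rfl | rfl | rfl)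
    exacts [vvec_mem_latticeN g _, vvec_mem_latticeN g _, e₁_mem_latticeN g]
  · set H := AddSubgroup.closure {vvec g k, vvec g (k + 1), (![1, 0, 0] : Fin 3 → ℚ)}
    have hv : vvec g k ∈ H := AddSubgroup.subset_closure (by simp)
    have hw : vvec g (k + 1) ∈ H := AddSubgroup.subset_closure (by simp)
    have h₁ : ![1, 0, 0] ∈ H := AddSubgroup.subset_closure (by simp)
    have hd := uvec_sub_e₃_mem hv hw
    have h₃ := e₃_mem_of_vvec_mem hv hd
    exact latticeN_le h₁ ((add_mem_cancel_left h₁).1 (e₁_add_e₂_mem h₃ hd)) h₃ (hu h₃ hd)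
  · rw [AddSubgroup.closure_le]
    rintro _ (rfl | rfl | rfl)
    exacts [vvec_mem_latticeN g _, vvec_mem_latticeN g _, e₂_mem_latticeN g]
  · set H := AddSubgroup.closure {vvec g k, vvec g (k + 1), (![0, 1, 0] : Fin 3 → ℚ)}
    have hv : vvec g k ∈ H := AddSubgroup.subset_closure (by simp)
    have hw : vvec g (k + 1) ∈ H := AddSubgroup.subset_closure (by simp)
    have h₂ : ![0, 1, 0] ∈ H := AddSubgroup.subset_closure (by simp)
    have hd := uvec_sub_e₃_mem hv hw
    have h₃ := e₃_mem_of_vvec_mem hv hd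
    exact latticeN_le ((add_mem_cancel_right h₂).1 (e₁_add_e₂_mem h₃ hd)) h₂ h₃ (hu h₃ hd)
  · rw [AddSubgroup.closure_le]
    rintro _ (rfl | rfl | rfl)
    exacts [vvec_mem_latticeN g _, e₁_mem_latticeN g, e₂_mem_latticeN g]
  · set H := AddSubgroup.closure
      {vvec g g, (![1, 0, 0] : Fin 3 → ℚ), (![0, 1, 0] : Fin 3 → ℚ)}
    have hv : vvec g g ∈ H := AddSubgroup.subset_closure (by simp)
    have h₁ : ![1, 0, 0] ∈ H := AddSubgroup.subset_closure (by simp)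
    have h₂ : ![0, 1, 0] ∈ H := AddSubgroup.subset_closure (by simp)
    have hd : uvec g - ![0, 0, 1] ∈ H := by
      rw [uvec_sub_e₃_eq]
      exact sub_mem (add_mem h₁ h₂) (nsmul_mem hv 2)
    have h₃ := e₃_mem_of_vvec_mem hv hd
    exact latticeN_le h₁ h₂ h₃ (hu h₃ hd)
end

section
/- Every point of the closed positive octant {(x,y,z) ∈ ℝ³ : x ≥ 0, y ≥ 0, z ≥ 0} lies in at least one of the following cones: the cone ℝ_{≥0}v_k + ℝ_{≥0}v_{k+1} + ℝ_{≥0}e₁ or the cone ℝ_{≥0}v_k + ℝ_{≥0}v_{k+1} + ℝ_{≥0}e₂ for some 0 ≤ k ≤ g−1, or the cone ℝ_{≥0}v_g + ℝ_{≥0}e₁ + ℝ_{≥0}e₂. Hence the cones of the fan Σ′ cover the positive octant, i.e., Σ′ is a subdivision of the fan of ℂ³/K. -/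
/-- The ray generators `v_k = (1/(2g+1))·(k, k, 2g+1−2k)` of the fan `Σ′` of the crepant
resolution `X = Hilb_K(ℂ³)`, as vectors of `ℝ³` (so that `v₀ = e₃`). -/
noncomputable def vvecR (g k : ℕ) : Fin 3 → ℝ :=
  (2 * (g : ℝ) + 1)⁻¹ • ![(k : ℝ), (k : ℝ), 2 * (g : ℝ) + 1 - 2 * (k : ℝ)]

/-- Membership in the (closed convex polyhedral) cone spanned by three vectors. -/
def inCone (a b c p : Fin 3 → ℝ) : Prop :=
  ∃ s t u : ℝ, 0 ≤ s ∧ 0 ≤ t ∧ 0 ≤ u ∧ p = s • a + t • b + u • c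

/-- A nonnegative `a < g * h` lies in one of the intervals `[k * h, (k + 1) * h]`, `k < g`. -/
theorem exists_mul_le_and_le_succ_mul {a h : ℝ} (ha : 0 ≤ a) (g : ℕ) (hlt : a < g * h) :
    ∃ k : ℕ, k + 1 ≤ g ∧ k * h ≤ a ∧ a ≤ (k + 1) * h := by
  induction g with
  | zero => simp at hlt; linarith
  | succ j ih =>
    rcases lt_or_ge a (j * h) with hj | hj
    · obtain ⟨k, hk, hka⟩ := ih hj
      exact ⟨k, by omega, hka⟩
    · exact ⟨j, le_rfl, hj, by push_cast at hlt; exact hlt.le⟩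

/-- The coordinates of `(m, m, z)` with respect to `v_k` and `v_{k+1}`. -/
theorem vvecR_combination (g k : ℕ) (m z : ℝ) :
    ![m, m, z] = ((k + 1) * (2 * m + z) - (2 * g + 1) * m) • vvecR g k +
      ((2 * g + 1) * m - k * (2 * m + z)) • vvecR g (k + 1) := by
  have hn : (2 * (g : ℝ) + 1) ≠ 0 := by positivity
  ext i
  fin_cases i <;> simp [vvecR] <;> field_simp <;> ring

/-- Every point of the closed positive octant lies in one of the maximal cones of the
fan `Σ′`: a cone `⟨v_k, v_{k+1}, e₁⟩` or `⟨v_k, v_{k+1}, e₂⟩` with `0 ≤ k ≤ g−1`, or the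
cone `⟨v_g, e₁, e₂⟩`.  Hence `Σ′` subdivides the fan of `ℂ³/K`. -/
theorem stmt_17 (g : ℕ) (hg : 3 ≤ g) (p : Fin 3 → ℝ) (hp : ∀ i, 0 ≤ p i) :
    (∃ k : ℕ, k + 1 ≤ g ∧
      (inCone (vvecR g k) (vvecR g (k + 1)) ![1, 0, 0] p ∨
       inCone (vvecR g k) (vvecR g (k + 1)) ![0, 1, 0] p)) ∨
    inCone (vvecR g g) ![1, 0, 0] ![0, 1, 0] p := by
  have hx := hp 0
  have hy := hp 1
  have hz := hp 2
  have hn : (2 * (g : ℝ) + 1) ≠ 0 := by positivity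
  have hm : 0 ≤ min (p 0) (p 1) := le_min hx hy
  rcases lt_or_ge ((2 * g + 1) * min (p 0) (p 1)) (g * (2 * min (p 0) (p 1) + p 2)) with h | h
  · left
    obtain ⟨k, hk, hlo, hhi⟩ := exists_mul_le_and_le_succ_mul (by positivity) g h
    refine ⟨k, hk, ?_⟩
    rcases le_total (p 1) (p 0) with hxy | hxy
    · left
      rw [min_eq_right hxy] at hlo hhi
      refine ⟨_, _, p 0 - p 1, sub_nonneg.2 hhi, sub_nonneg.2 hlo, sub_nonneg.2 hxy, ?_⟩
      rw [← vvecR_combination]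
      ext i
      fin_cases i <;> simp
    · right
      rw [min_eq_left hxy] at hlo hhi
      refine ⟨_, _, p 1 - p 0, sub_nonneg.2 hhi, sub_nonneg.2 hlo, sub_nonneg.2 hxy, ?_⟩
      rw [← vvecR_combination]
      ext i
      fin_cases i <;> simp
  · right
    have hmx := min_le_left (p 0) (p 1)
    have hmy := min_le_right (p 0) (p 1)
    refine ⟨(2 * g + 1) * p 2, p 0 - g * p 2, p 1 - g * p 2, by positivity,
      by linarith, by linarith, ?_⟩
    ext i
    fin_cases i <;> simp [vvecR] <;> field_simp <;> ring
end

section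
/- Every G-invariant homogeneous polynomial of degree 4g−1 in ℂ[z₁,z₂,z₃] lies in I·F_{4g−3} + F_{6g−3}, where I·F_{4g−3} denotes the set of sums of products of an element of I with an element of F_{4g−3}. (In particular no pure power zᵢ^{4g−1} is G-invariant, since 2g+1 does not divide 3.) -/
open MvPolynomial

theorem MvPolynomial.coeff_aeval_C_mul_X {σ R : Type*} [CommSemiring R] (t : σ → R)
    (p : MvPolynomial σ R) (d : σ →₀ ℕ) :
    coeff d (aeval (fun i => C (t i) * X i) p) = (d.prod fun i e => t i ^ e) * coeff d p := by
  classical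
  induction p using MvPolynomial.induction_on' with
  | monomial u a =>
    have h : aeval (fun i => C (t i) * X i) (monomial u a) =
        monomial u ((u.prod fun i e => t i ^ e) * a) := by
      rw [aeval_monomial, algebraMap_eq, mul_comm _ a, ← C_mul_monomial, monomial_eq]
      simp only [mul_pow, Finsupp.prod, map_prod, map_pow, Finset.prod_mul_distrib]
    rw [h, coeff_monomial, coeff_monomial]
    split_ifs with h1
    · rw [h1]
    · simp
  | add p q hp hq => rw [map_add, coeff_add, coeff_add, hp, hq, mul_add]

theorem monomial_mem_Fdeg {m : ℕ} {d : Fin 3 →₀ ℕ} (h : m ≤ d 0 + d 1 + d 2) (a : ℂ) :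
    monomial d a ∈ Fdeg m := by
  intro e he
  obtain rfl := Finset.mem_singleton.mp (support_monomial_subset he)
  rwa [Finsupp.sum_fintype _ _ (fun _ => rfl), Fin.sum_univ_three]

theorem pderiv_superpotential {g : ℕ} {i j k : Fin 3} (hij : i ≠ j) (hik : i ≠ k) (hjk : j ≠ k) :
    pderiv k (superpotential g) = - (X i * X j) + C (2 * g + 1 : ℂ) * X k ^ (2 * g) := by
  have h2 : (C 2 : MvPolynomial (Fin 3) ℂ) = 2 := map_ofNat C 2
  fin_cases i <;> fin_cases j <;> fin_cases k <;>
    first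
    | contradiction
    | (simp [superpotential, Derivation.leibniz_pow, pderiv_X, h2] <;> ring)

theorem pderiv_superpotential_mem (g : ℕ) (k : Fin 3) :
    pderiv k (superpotential g) ∈ jacobianIdeal g := by
  apply Ideal.subset_span
  fin_cases k <;> simp

/-- Modulo `I`, the product `zᵢzⱼ` of two distinct variables may be traded for a multiple of
`zₖ^{2g}`, which raises the degree by `2g-2`. -/
theorem monomial_mem_of_two_variables {g m : ℕ} {d : Fin 3 →₀ ℕ} {i j : Fin 3} (hij : i ≠ j)
    (hi : d i ≠ 0) (hj : d j ≠ 0) (hd : d 0 + d 1 + d 2 = m + 2) (a : ℂ) :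
    monomial d a ∈ jacobianIdeal g * Fdeg m + Fdeg (m + 2 * g) := by
  obtain ⟨k, hik, hjk⟩ : ∃ k, i ≠ k ∧ j ≠ k := by
    clear hi hj
    revert i j
    decide
  obtain ⟨e, rfl⟩ : ∃ e : Fin 3 →₀ ℕ,
      d = Finsupp.single i 1 + Finsupp.single j 1 + e := by
    refine ⟨d - (Finsupp.single i 1 + Finsupp.single j 1), (add_tsub_cancel_of_le ?_).symm⟩
    intro l
    by_cases hil : i = l
    · subst hil
      simp [hij.symm]
      omega
    · by_cases hjl : j = l
      · subst hjl
        simp [hij]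
        omega
      · simp [hil, hjl]
  have he : e 0 + e 1 + e 2 = m := by
    have hs : ∀ l : Fin 3, (Finsupp.single l 1 : Fin 3 →₀ ℕ) 0 +
        (Finsupp.single l 1 : Fin 3 →₀ ℕ) 1 + (Finsupp.single l 1 : Fin 3 →₀ ℕ) 2 = 1 := by
      intro l; fin_cases l <;> simp
    have := hs i
    have := hs j
    simp only [Finsupp.add_apply] at hd
    omega
  have hpow : (Finsupp.single k (2 * g) : Fin 3 →₀ ℕ) 0 +
      (Finsupp.single k (2 * g) : Fin 3 →₀ ℕ) 1 +
      (Finsupp.single k (2 * g) : Fin 3 →₀ ℕ) 2 = 2 * g := by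
    fin_cases k <;> simp
  have hmon : monomial (Finsupp.single i 1 + Finsupp.single j 1 + e) a =
      pderiv k (superpotential g) * - monomial e a +
        C (2 * g + 1 : ℂ) * monomial (Finsupp.single k (2 * g) + e) a := by
    have h1 : monomial (Finsupp.single i 1 + Finsupp.single j 1 + e) a =
        X i * X j * monomial e a := by
      simp [X, monomial_mul]
    have h2 : monomial (Finsupp.single k (2 * g) + e) a = X k ^ (2 * g) * monomial e a := by
      simp [X_pow_eq_monomial, monomial_mul]
    rw [h1, h2, pderiv_superpotential hij hik hjk]
    ring
  rw [hmon]
  refine Submodule.add_mem_sup (Ideal.mul_mem_mul (pderiv_superpotential_mem g k)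
    (neg_mem (monomial_mem_Fdeg he.ge a))) (Ideal.mul_mem_left _ _ (monomial_mem_Fdeg ?_ a))
  simp only [Finsupp.add_apply]
  omega

/-- If `zᵢ^m` has nonzero coefficient in a `G`-invariant polynomial, then `2g+1` divides `m`. -/
theorem dvd_of_coeff_single_ne_zero {g m : ℕ} {p : MvPolynomial (Fin 3) ℂ}
    (hinv : ∀ t : Fin 3 → ℂ, (∀ i, t i ^ (2 * g + 1) = 1) → t 0 * t 1 * t 2 = 1 →
      aeval (fun i => C (t i) * X i) p = p)
    {i : Fin 3} (h : coeff (Finsupp.single i m) p ≠ 0) : 2 * g + 1 ∣ m := by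
  obtain ⟨ζ, hζ⟩ : ∃ ζ : ℂ, IsPrimitiveRoot ζ (2 * g + 1) :=
    ⟨_, Complex.isPrimitiveRoot_exp _ (by omega)⟩
  have hζ0 : ζ ≠ 0 := hζ.ne_zero (by omega)
  obtain ⟨t, hti, ht, hprod⟩ : ∃ t : Fin 3 → ℂ, t i = ζ ∧ (∀ l, t l ^ (2 * g + 1) = 1) ∧
      t 0 * t 1 * t 2 = 1 := by
    refine ⟨fun l => if l = i then ζ else if l = i + 1 then ζ⁻¹ else 1, by simp, ?_, ?_⟩
    · intro l
      dsimp only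
      split_ifs <;> simp [hζ.pow_eq_one]
    · fin_cases i <;> simp [hζ0]
  have hc := coeff_aeval_C_mul_X t p (Finsupp.single i m)
  rw [hinv t ht hprod, Finsupp.prod_single_index (h := fun i e => t i ^ e) (pow_zero _), hti] at hc
  exact hζ.dvd_of_pow_eq_one m (mul_right_cancel₀ h (by rw [one_mul]; exact hc.symm))

/-- Every `G`-invariant homogeneous polynomial of degree `4g−1` (invariance being under
all substitutions `zᵢ ↦ tᵢzᵢ` with `tᵢ^{2g+1} = 1` and `t₁t₂t₃ = 1`) lies in
`I·F_{4g−3} + F_{6g−3}`. -/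
theorem stmt_18 (g : ℕ) (hg : 3 ≤ g) (p : MvPolynomial (Fin 3) ℂ)
    (hhom : p.IsHomogeneous (4 * g - 1))
    (hinv : ∀ t : Fin 3 → ℂ, (∀ i, t i ^ (2 * g + 1) = 1) → t 0 * t 1 * t 2 = 1 →
      aeval (fun i => C (t i) * X i) p = p) :
    p ∈ jacobianIdeal g * Fdeg (4 * g - 3) + Fdeg (6 * g - 3) := by
  rw [p.as_sum]
  refine Ideal.sum_mem _ fun d hd => ?_
  have hcoeff : coeff d p ≠ 0 := mem_support_iff.mp hd
  have hdeg : d 0 + d 1 + d 2 = 4 * g - 1 := by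
    have := hhom hcoeff
    simpa [Finsupp.weight_apply, Finsupp.sum_fintype, Fin.sum_univ_three] using this
  obtain ⟨i, hi⟩ : ∃ i, d i ≠ 0 := by
    by_contra! h
    simp only [h] at hdeg
    omega
  obtain ⟨j, hij, hj⟩ : ∃ j, i ≠ j ∧ d j ≠ 0 := by
    by_contra! h
    have hsingle : d = Finsupp.single i (d i) := by
      ext l
      by_cases hl : i = l
      · simp [hl]
      · simp [hl, h l hl]
    have hdi : d i = 4 * g - 1 := by
      rw [hsingle] at hdeg
      revert hdeg
      generalize d i = m
      fin_cases i <;> simp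
    rw [hsingle, hdi] at hcoeff
    have hdvd := dvd_of_coeff_single_ne_zero hinv hcoeff
    have h3 : 2 * g + 1 ∣ 3 := by
      have := (Nat.dvd_sub (Dvd.intro_left 2 rfl : 2 * g + 1 ∣ 2 * (2 * g + 1)) hdvd)
      rwa [show 2 * (2 * g + 1) - (4 * g - 1) = 3 by omega] at this
    have := Nat.le_of_dvd (by norm_num) h3
    omega
  have := monomial_mem_of_two_variables (g := g) (m := 4 * g - 3) hij hi hj (by omega) (coeff d p)
  rwa [show 4 * g - 3 + 2 * g = 6 * g - 3 by omega] at this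
end
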